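/- arXiv:2402.13477 — 2 statements merged into one kernel-verified Lean document; each statement's English description precedes it below -/
import Mathlib

section
/- Let K be a field, 2 ≤ t ≤ n, and S = K[x_1,…,x_n]. For every s ≥ 1, the set of associated primes of the S-module S/I_t(L_n)^s is exactly { p_F : F ∈ C_{n,t} }, where p_F = (x_i : i ∈ F). -/
open MvPolynomial

/-- Generator of the path ideal: the product `x_{i+1} ⋯ x_{i+t}` of the variables with
0-based indices in `[i, i+t)`. -/
noncomputable def pathGen (K : Type*) [Field K] (n t i : ℕ) : MvPolynomial (Fin n) K :=
  ∏ j ∈ Finset.univ.filter (fun j : Fin n => i ≤ (j : ℕ) ∧ (j : ℕ) < i + t), X j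

/-- The `t`-path ideal `I_t(L_n)` of the line graph `L_n`. -/
noncomputable def pathIdeal (K : Type*) [Field K] (n t : ℕ) : Ideal (MvPolynomial (Fin n) K) :=
  Ideal.span ((pathGen K n t) '' {i : ℕ | i + t ≤ n})

/-- The collection `C_{n,t}` of subsets `{i₁ < i₂ < ⋯ < i_r}` of `{1,…,n}` with
(1) `i₁ ≤ t`; (2) `i₂ > t`; (3) `i_{j+1} - i_j ≤ t`; (4) `i_{j+2} - i_j > t`;
(5) `i_{r-1} < n - t + 1`; (6) `n - t + 1 ≤ i_r ≤ n`. -/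
def memC (n t : ℕ) (F : Finset ℕ) : Prop :=
  ∃ (r : ℕ) (hr : 1 ≤ r) (f : Fin r → ℕ),
    StrictMono f ∧ F = Finset.image f Finset.univ ∧
    (∀ j, 1 ≤ f j ∧ f j ≤ n) ∧
    f ⟨0, by omega⟩ ≤ t ∧
    (∀ h : 1 < r, t < f ⟨1, h⟩) ∧
    (∀ j : ℕ, ∀ h : j + 1 < r, f ⟨j + 1, h⟩ - f ⟨j, by omega⟩ ≤ t) ∧
    (∀ j : ℕ, ∀ h : j + 2 < r, t < f ⟨j + 2, h⟩ - f ⟨j, by omega⟩) ∧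
    (∀ _ : 2 ≤ r, f ⟨r - 2, by omega⟩ < n - t + 1) ∧
    n - t + 1 ≤ f ⟨r - 1, by omega⟩

/-- The monomial prime ideal `p_F = (x_i : i ∈ F)` for `F ⊆ {1,…,n}` (1-based). -/
noncomputable def pF (K : Type*) [Field K] (n : ℕ) (F : Finset ℕ) :
    Ideal (MvPolynomial (Fin n) K) :=
  Ideal.span ((fun j : Fin n => X j) '' {j : Fin n | (j : ℕ) + 1 ∈ F})


/-- `G` meets every window of `t` consecutive indices in `Fin n`. -/
def IsWindowCover (n t : ℕ) (G : Finset (Fin n)) : Prop :=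
  ∀ i : ℕ, i + t ≤ n → ∃ j ∈ G, i ≤ (j : ℕ) ∧ (j : ℕ) < i + t

theorem memC.exists_minimal_isWindowCover {n t : ℕ} (htn : t ≤ n) {F : Finset ℕ}
    (hF : memC n t F) :
    ∃ G : Finset (Fin n), Minimal (IsWindowCover n t) G ∧
      F = G.image (fun j : Fin n => (j : ℕ) + 1) := by
  obtain ⟨r, hr, f, hmono, rfl, hbd, h1, h2, h3, h4, h5, h6⟩ := hF
  let g : Fin r → Fin n := fun k => ⟨f k - 1, by have := hbd k; omega⟩
  have hg : ∀ k, ((g k : Fin n) : ℕ) + 1 = f k := fun k => by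
    have := hbd k
    simp only [g]
    omega
  refine ⟨Finset.univ.image g, ⟨?_, ?_⟩, ?_⟩
  · intro i hi
    have hex : ∃ k, ∃ h : k < r, i + 1 ≤ f ⟨k, h⟩ := ⟨r - 1, by omega, by omega⟩
    classical
    obtain ⟨hk, hik⟩ := Nat.find_spec hex
    have hmin : ∀ m, m < Nat.find hex → _ := fun m hm => Nat.find_min hex hm
    generalize Nat.find hex = k at hk hik hmin
    refine ⟨g ⟨k, hk⟩, Finset.mem_image_of_mem _ (Finset.mem_univ _), ?_⟩
    have := hg ⟨k, hk⟩
    rcases k with _ | k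
    · omega
    · have h3' := h3 k hk
      have hm := hmin k (by omega)
      simp only [not_exists, not_le] at hm
      have := hm (by omega)
      omega
  · intro H hH hHG j hj
    obtain ⟨k, -, rfl⟩ := Finset.mem_image.1 hj
    suffices ∃ i, i + t ≤ n ∧ ∀ l, i ≤ (g l : ℕ) → (g l : ℕ) < i + t → l = k by
      obtain ⟨i, hi, hik⟩ := this
      obtain ⟨j, hjH, hij, hji⟩ := hH i hi
      obtain ⟨l, -, rfl⟩ := Finset.mem_image.1 (hHG hjH)
      rwa [hik l hij hji] at hjH
    obtain ⟨k, hk⟩ := k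
    have hlt : ∀ (a b : ℕ) (ha : a < r) (hb : b < r), a ≤ b → f ⟨a, ha⟩ ≤ f ⟨b, hb⟩ :=
      fun a b ha hb hab => hmono.monotone (Fin.mk_le_mk.2 hab)
    by_cases hlast : k = r - 1
    · refine ⟨n - t, by omega, ?_⟩
      rintro ⟨l, hl⟩ hl1 -
      have hgl := hg ⟨l, hl⟩
      rw [Fin.mk.injEq]
      by_contra hne
      have := hlt l (r - 2) hl (by omega) (by omega)
      have := h5 (by omega)
      omega
    · rcases k with _ | k
      · refine ⟨0, by omega, ?_⟩
        rintro ⟨l, hl⟩ - hl1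
        have hgl := hg ⟨l, hl⟩
        rw [Fin.mk.injEq]
        by_contra hne
        have := hlt 1 l (by omega) hl (by omega)
        have := h2 (by omega)
        omega
      · have hk2 : k + 2 < r := by omega
        have := h4 k hk2
        have hb := hbd ⟨k + 2, hk2⟩
        refine ⟨f ⟨k, by omega⟩, by omega, ?_⟩
        rintro ⟨l, hl⟩ hl1 hl2
        have hgl := hg ⟨l, hl⟩
        rw [Fin.mk.injEq]
        by_contra hne
        rcases Nat.lt_or_gt_of_ne hne with hlk | hlk
        · have := hlt l k hl (by omega) (by omega)
          omega
        · have := hlt (k + 2) l hk2 hl (by omega)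
          omega
  · ext x
    simp [hg]

theorem memC_image_of_minimal {n t : ℕ} (htn : t ≤ n) {G : Finset (Fin n)}
    (hG : Minimal (IsWindowCover n t) G) :
    memC n t (G.image (fun j : Fin n => (j : ℕ) + 1)) := by
  obtain ⟨hcov, hmin⟩ := hG
  have hne : 1 ≤ G.card := by
    obtain ⟨j, hj, -⟩ := hcov 0 (by omega)
    exact Finset.card_pos.2 ⟨j, hj⟩
  let e := G.orderEmbOfFin rfl
  have he : ∀ j ∈ G, ∃ k, e k = j := fun j hj => by
    have : j ∈ Set.range e := by rw [Finset.range_orderEmbOfFin]; exact hj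
    exact this
  have heG : ∀ k, e k ∈ G := fun k => G.orderEmbOfFin_mem rfl k
  have hwin : ∀ i, i + t ≤ n → ∃ k, ∃ h : k < G.card,
      i ≤ (e ⟨k, h⟩ : ℕ) ∧ (e ⟨k, h⟩ : ℕ) < i + t := by
    intro i hi
    obtain ⟨j, hj, hij⟩ := hcov i hi
    obtain ⟨⟨k, hk⟩, rfl⟩ := he j hj
    exact ⟨k, hk, hij⟩
  have hle : ∀ (a b : ℕ) (ha : a < G.card) (hb : b < G.card), a ≤ b →
      (e ⟨a, ha⟩ : ℕ) ≤ (e ⟨b, hb⟩ : ℕ) :=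
    fun a b ha hb hab => e.monotone (Fin.mk_le_mk.2 hab)
  have hlt : ∀ (a b : ℕ) (ha : a < G.card) (hb : b < G.card), a < b →
      (e ⟨a, ha⟩ : ℕ) < (e ⟨b, hb⟩ : ℕ) :=
    fun a b ha hb hab => e.strictMono (Fin.mk_lt_mk.2 hab)
  have hpriv : ∀ (k : ℕ) (hk : k < G.card), ∃ i, i + t ≤ n ∧ i ≤ (e ⟨k, hk⟩ : ℕ) ∧
      (e ⟨k, hk⟩ : ℕ) < i + t ∧ ∀ (l : ℕ) (hl : l < G.card), l ≠ k →
        ¬ (i ≤ (e ⟨l, hl⟩ : ℕ) ∧ (e ⟨l, hl⟩ : ℕ) < i + t) := by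
    intro k hk
    by_contra! hcon
    have : IsWindowCover n t (G.erase (e ⟨k, hk⟩)) := by
      intro i hi
      obtain ⟨l, hl, hl1, hl2⟩ := hwin i hi
      by_cases hlk : l = k
      · subst hlk
        obtain ⟨m, hm, hmk, hm1, hm2⟩ := hcon i hi hl1 hl2
        exact ⟨_, Finset.mem_erase.2
          ⟨fun h => hmk (by simpa using e.injective h), heG _⟩, hm1, hm2⟩
      · exact ⟨_, Finset.mem_erase.2
          ⟨fun h => hlk (by simpa using e.injective h), heG _⟩, hl1, hl2⟩
    exact Finset.notMem_erase _ _ (hmin this (Finset.erase_subset _ _) (heG ⟨k, hk⟩))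
  refine ⟨G.card, hne, fun k => (e k : ℕ) + 1, fun a b hab => ?_, ?_, fun j => ?_, ?_, ?_,
    ?_, ?_, ?_, ?_⟩
  · beta_reduce
    have : (e a : ℕ) < e b := e.strictMono hab
    omega
  · ext x
    simp only [Finset.mem_image, Finset.mem_univ, true_and]
    constructor
    · rintro ⟨j, hj, rfl⟩
      obtain ⟨k, rfl⟩ := he j hj
      exact ⟨k, rfl⟩
    · rintro ⟨k, rfl⟩
      exact ⟨_, heG k, rfl⟩
  · beta_reduce
    have := (e j).isLt
    omega
  · beta_reduce
    obtain ⟨k, hk, -, hk2⟩ := hwin 0 (by omega)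
    have := hle 0 k (by omega) hk (by omega)
    omega
  · intro h
    beta_reduce
    obtain ⟨i, hi, hi1, hi2, hi3⟩ := hpriv 0 (by omega)
    have := hlt 0 1 (by omega) h (by omega)
    have := hi3 1 h (by omega)
    omega
  · intro j hj
    beta_reduce
    by_contra hcon
    have hn := (e ⟨j + 1, hj⟩).isLt
    obtain ⟨k, hk, hk1, hk2⟩ := hwin (e ⟨j, by omega⟩ + 1) (by omega)
    rcases Nat.lt_or_ge j k with hjk | hjk
    · have := hle (j + 1) k hj hk (by omega)
      omega
    · have := hle k j hk (by omega) hjk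
      omega
  · intro j hj
    beta_reduce
    obtain ⟨i, hi, hi1, hi2, hi3⟩ := hpriv (j + 1) (by omega)
    have := hi3 j (by omega) (by omega)
    have := hi3 (j + 2) hj (by omega)
    have := hlt j (j + 1) (by omega) (by omega) (by omega)
    have := hlt (j + 1) (j + 2) (by omega) (by omega) (by omega)
    omega
  · intro h
    beta_reduce
    obtain ⟨i, hi, hi1, hi2, hi3⟩ := hpriv (G.card - 1) (by omega)
    have := hi3 (G.card - 2) (by omega) (by omega)
    have := hlt (G.card - 2) (G.card - 1) (by omega) (by omega) (by omega)
    omega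
  · beta_reduce
    obtain ⟨k, hk, hk1, -⟩ := hwin (n - t) (by omega)
    have := hle k (G.card - 1) hk (by omega) (by omega)
    omega

/-- If every cover has weight at least `s + 1`, the leftmost window in the support of the weight
can be removed so that every cover still has weight at least `s`. -/
theorem exists_window_removal {n t s : ℕ} (a : Fin n → ℕ)
    (ha : ∀ G, IsWindowCover n t G → s + 1 ≤ ∑ j ∈ G, a j) :
    ∃ p, p + t ≤ n ∧ (∀ j : Fin n, p ≤ (j : ℕ) → (j : ℕ) < p + t → 1 ≤ a j) ∧
      ∀ G, IsWindowCover n t G →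
        s ≤ ∑ j ∈ G, (a j - if p ≤ (j : ℕ) ∧ (j : ℕ) < p + t then 1 else 0) := by
  classical
  have hex : ∃ p, p + t ≤ n ∧ ∀ j : Fin n, p ≤ (j : ℕ) → (j : ℕ) < p + t → 1 ≤ a j := by
    by_contra! hcon
    have hcov : IsWindowCover n t (Finset.univ.filter fun j => a j = 0) := by
      intro i hi
      obtain ⟨j, hj1, hj2, hj3⟩ := hcon i hi
      exact ⟨j, by simp; omega, hj1, hj2⟩
    have := ha _ hcov
    rw [Finset.sum_eq_zero (fun j hj => (Finset.mem_filter.1 hj).2)] at this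
    omega
  obtain ⟨hp, hpa⟩ := Nat.find_spec hex
  have hmin : ∀ m, m < Nat.find hex → _ := fun m hm => Nat.find_min hex hm
  generalize Nat.find hex = p at hp hpa hmin
  refine ⟨p, hp, hpa, fun G hG => ?_⟩
  set u : Fin n → ℕ := fun j => if p ≤ (j : ℕ) ∧ (j : ℕ) < p + t then 1 else 0 with hu
  have hUne : (G.filter fun j : Fin n => p ≤ (j : ℕ) ∧ (j : ℕ) < p + t).Nonempty := by
    obtain ⟨j, hj, hjp⟩ := hG p hp
    exact ⟨j, Finset.mem_filter.2 ⟨hj, hjp⟩⟩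
  change s ≤ ∑ j ∈ G, (a j - u j)
  obtain ⟨m, hm, hmmax⟩ := Finset.exists_max_image _ (fun j : Fin n => (j : ℕ)) hUne
  simp only [Finset.mem_filter, and_imp] at hm hmmax
  obtain ⟨hmG, hpm, hmp⟩ := hm
  let G' : Finset (Fin n) := Finset.univ.filter fun j =>
    ((j : ℕ) < p + t ∧ (a j = 0 ∨ j = m)) ∨ (p + t ≤ (j : ℕ) ∧ j ∈ G)
  have hG' : IsWindowCover n t G' := by
    intro i hi
    rcases lt_trichotomy i p with hip | rfl | hip
    · have := hmin i hip
      push Not at this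
      obtain ⟨j, hj1, hj2, hj3⟩ := this hi
      exact ⟨j, by simp only [G', Finset.mem_filter, Finset.mem_univ, true_and]; omega, hj1, hj2⟩
    · exact ⟨m, by simp [G', hmp], hpm, hmp⟩
    · obtain ⟨j, hj, hj1, hj2⟩ := hG i hi
      by_cases hjp : p + t ≤ (j : ℕ)
      · exact ⟨j, by simp [G', hjp, hj], hj1, hj2⟩
      · have := hmmax j hj (by omega) (by omega)
        exact ⟨m, by simp [G', hmp], by omega, by omega⟩
  have h1 : s + 1 ≤ ∑ j ∈ G', a j := ha G' hG'
  have h2 : ∑ j ∈ G', a j ≤ ∑ j ∈ G', (a j - u j) + ∑ j ∈ G', u j := by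
    rw [← Finset.sum_add_distrib]
    exact Finset.sum_le_sum fun j _ => by omega
  have h3 : ∑ j ∈ G', u j ≤ 1 := by
    calc ∑ j ∈ G', u j ≤ ∑ j ∈ G', if j = m then 1 else 0 := by
          refine Finset.sum_le_sum fun j hj => ?_
          simp only [G', Finset.mem_filter, Finset.mem_univ, true_and] at hj
          have := hpa j
          simp only [hu]
          split_ifs <;> omega
      _ ≤ 1 := by
          rw [Finset.sum_ite_eq']
          split_ifs <;> omega
  have h4 : ∑ j ∈ G', (a j - u j) ≤ ∑ j ∈ G, (a j - u j) := by
    refine Finset.sum_le_sum_of_ne_zero fun j hj hne => ?_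
    simp only [G', Finset.mem_filter, Finset.mem_univ, true_and] at hj
    rcases hj with ⟨-, h | rfl⟩ | ⟨-, h⟩
    · omega
    · exact hmG
    · exact h
  omega

theorem pathGen_eq_monomial (K : Type*) [Field K] (n t i : ℕ) :
    pathGen K n t i = monomial (Finsupp.equivFunOnFinite.symm
      fun j : Fin n => if i ≤ (j : ℕ) ∧ (j : ℕ) < i + t then 1 else 0) 1 := by
  rw [monomial_eq, pathGen, Finset.prod_filter, map_one, one_mul,
    Finsupp.prod_fintype _ _ (fun _ => pow_zero _)]
  refine Finset.prod_congr rfl fun j _ => ?_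
  simp only [Finsupp.equivFunOnFinite_symm_apply_apply]
  split_ifs <;> simp

theorem monomial_mem_pathIdeal_pow (K : Type*) [Field K] {n t : ℕ} (s : ℕ) (a : Fin n →₀ ℕ)
    (ha : ∀ G, IsWindowCover n t G → s ≤ ∑ j ∈ G, a j) :
    monomial a (1 : K) ∈ pathIdeal K n t ^ s := by
  induction s generalizing a with
  | zero => simp
  | succ s ih =>
    obtain ⟨p, hp, hpa, hrem⟩ := exists_window_removal a ha
    set u : Fin n →₀ ℕ := Finsupp.equivFunOnFinite.symm
      fun j : Fin n => if p ≤ (j : ℕ) ∧ (j : ℕ) < p + t then 1 else 0 with hu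
    have hle : u ≤ a := fun j => by
      simp only [hu, Finsupp.equivFunOnFinite_symm_apply_apply]
      split_ifs with h
      · exact hpa j h.1 h.2
      · exact Nat.zero_le _
    have : monomial a (1 : K) = monomial (a - u) 1 * pathGen K n t p := by
      rw [pathGen_eq_monomial, monomial_mul, mul_one, tsub_add_cancel_of_le hle]
    rw [this, pow_succ]
    refine Ideal.mul_mem_mul (ih _ fun G hG => ?_) (Ideal.subset_span ⟨p, hp, rfl⟩)
    simpa [hu] using hrem G hG

/-- The algebra map scaling the variables in `G` by a new variable, which records the order
along the prime generated by these variables. -/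
noncomputable def scaleVars (K : Type*) [Field K] {n : ℕ} (G : Finset (Fin n)) :
    MvPolynomial (Fin n) K →ₐ[K] Polynomial (MvPolynomial (Fin n) K) :=
  aeval fun j => Polynomial.C (X j) * if j ∈ G then Polynomial.X else 1

theorem scaleVars_monomial (K : Type*) [Field K] {n : ℕ} (G : Finset (Fin n)) (a : Fin n →₀ ℕ)
    (c : K) :
    scaleVars K G (monomial a c) =
      Polynomial.monomial (∑ j ∈ G, a j) (monomial a c) := by
  rw [scaleVars, aeval_monomial, ← Polynomial.C_mul_X_pow_eq_monomial,
    Finsupp.prod_fintype _ _ (fun _ => pow_zero _), monomial_eq,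
    Finsupp.prod_fintype _ _ (fun _ => pow_zero _)]
  simp only [mul_pow, Finset.prod_mul_distrib, ite_pow, one_pow, map_mul, map_prod, map_pow,
    Finset.prod_ite_mem, Finset.univ_inter, Finset.prod_pow_eq_pow_sum, mul_assoc]
  rfl

theorem coeff_coeff_scaleVars (K : Type*) [Field K] {n : ℕ} (G : Finset (Fin n))
    (f : MvPolynomial (Fin n) K) (a : Fin n →₀ ℕ) (k : ℕ) :
    coeff a ((scaleVars K G f).coeff k) = if ∑ j ∈ G, a j = k then coeff a f else 0 := by
  induction f using MvPolynomial.induction_on' with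
  | monomial b c =>
    rw [scaleVars_monomial, Polynomial.coeff_monomial]
    by_cases hab : b = a
    · subst hab
      split_ifs <;> simp
    · split_ifs <;> simp [coeff_monomial, hab]
  | add p q hp hq =>
    rw [map_add, Polynomial.coeff_add, coeff_add, hp, hq, coeff_add]
    split_ifs <;> simp

theorem X_pow_dvd_scaleVars_iff (K : Type*) [Field K] {n : ℕ} (G : Finset (Fin n))
    (f : MvPolynomial (Fin n) K) (s : ℕ) :
    Polynomial.X ^ s ∣ scaleVars K G f ↔ ∀ a ∈ f.support, s ≤ ∑ j ∈ G, a j := by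
  rw [Polynomial.X_pow_dvd_iff]
  constructor
  · intro h a ha
    by_contra! hlt
    have := coeff_coeff_scaleVars K G f a (∑ j ∈ G, a j)
    rw [h _ hlt, if_pos rfl, coeff_zero] at this
    exact mem_support_iff.1 ha this.symm
  · intro h d hd
    ext a
    rw [coeff_coeff_scaleVars, coeff_zero]
    split_ifs with had
    · by_contra hne
      have := h a (mem_support_iff.2 hne)
      omega
    · rfl

theorem X_dvd_scaleVars_iff (K : Type*) [Field K] {n : ℕ} (G : Finset (Fin n))
    (f : MvPolynomial (Fin n) K) :
    Polynomial.X ∣ scaleVars K G f ↔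
      f ∈ Ideal.span (X '' (G : Set (Fin n)) : Set (MvPolynomial (Fin n) K)) := by
  rw [← pow_one (Polynomial.X), X_pow_dvd_scaleVars_iff, mem_ideal_span_X_image]
  refine forall₂_congr fun a _ => ?_
  rw [Nat.one_le_iff_ne_zero, Ne, Finset.sum_eq_zero_iff]
  simp

theorem isPrime_span_X_image (K : Type*) [Field K] {n : ℕ} (G : Finset (Fin n)) :
    (Ideal.span (X '' (G : Set (Fin n)) : Set (MvPolynomial (Fin n) K))).IsPrime := by
  have : Ideal.span (X '' (G : Set (Fin n)) : Set (MvPolynomial (Fin n) K)) =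
      (Ideal.span {Polynomial.X}).comap (scaleVars K G) := by
    ext f
    rw [Ideal.mem_comap, Ideal.mem_span_singleton, X_dvd_scaleVars_iff]
  rw [this]
  have := (Ideal.span_singleton_prime (Polynomial.X_ne_zero (R := MvPolynomial (Fin n) K))).2
    Polynomial.prime_X
  exact Ideal.comap_isPrime _ _

theorem pathIdeal_le_span_X_image (K : Type*) [Field K] {n t : ℕ} {G : Finset (Fin n)}
    (hG : IsWindowCover n t G) :
    pathIdeal K n t ≤ Ideal.span (X '' (G : Set (Fin n)) : Set (MvPolynomial (Fin n) K)) := by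
  rw [pathIdeal, Ideal.span_le]
  rintro _ ⟨i, hi, rfl⟩
  obtain ⟨j, hj, hij⟩ := hG i hi
  exact Ideal.mem_of_dvd _ (Finset.dvd_prod_of_mem _ (by simpa using hij))
    (Ideal.subset_span ⟨j, hj, rfl⟩)

theorem mem_pathIdeal_pow_iff (K : Type*) [Field K] {n t : ℕ} (s : ℕ)
    (f : MvPolynomial (Fin n) K) :
    f ∈ pathIdeal K n t ^ s ↔
      ∀ G, Minimal (IsWindowCover n t) G → Polynomial.X ^ s ∣ scaleVars K G f := by
  constructor
  · intro hf G hG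
    have hle : pathIdeal K n t ≤ (Ideal.span {Polynomial.X}).comap (scaleVars K G) :=
      fun g hg => by
        rw [Ideal.mem_comap, Ideal.mem_span_singleton, X_dvd_scaleVars_iff]
        exact pathIdeal_le_span_X_image K hG.prop hg
    have := Ideal.le_comap_pow _ s (Ideal.pow_right_mono hle s hf)
    rwa [Ideal.mem_comap, Ideal.span_singleton_pow, Ideal.mem_span_singleton] at this
  · intro h
    rw [f.as_sum]
    refine Ideal.sum_mem _ fun a ha => ?_
    have : monomial a (coeff a f) = C (coeff a f) * monomial a 1 := by
      rw [C_mul_monomial, mul_one]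
    rw [this]
    refine Ideal.mul_mem_left _ _ (monomial_mem_pathIdeal_pow K s a fun G hG => ?_)
    obtain ⟨H, hHG, hH⟩ := exists_minimal_le_of_wellFoundedLT (IsWindowCover n t) G hG
    exact ((X_pow_dvd_scaleVars_iff K H f s).1 (h H hH) a ha).trans
      (Finset.sum_le_sum_of_subset hHG)

theorem pF_image (K : Type*) [Field K] {n : ℕ} (G : Finset (Fin n)) :
    pF K n (G.image (fun j : Fin n => (j : ℕ) + 1)) =
      Ideal.span (X '' (G : Set (Fin n)) : Set (MvPolynomial (Fin n) K)) := by
  have : {j : Fin n | (j : ℕ) + 1 ∈ G.image (fun j : Fin n => (j : ℕ) + 1)} =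
      (G : Set (Fin n)) := by
    ext j
    simp [Fin.val_inj]
  rw [pF, this]

theorem exists_minimal_of_mem_associatedPrimes (K : Type*) [Field K] {n t s : ℕ}
    {P : Ideal (MvPolynomial (Fin n) K)}
    (hP : P ∈ associatedPrimes (MvPolynomial (Fin n) K)
      (MvPolynomial (Fin n) K ⧸ (pathIdeal K n t ^ s))) :
    ∃ G, Minimal (IsWindowCover n t) G ∧ P = Ideal.span (X '' (G : Set (Fin n))) := by
  classical
  rw [AssociatedPrimes.mem_iff, isAssociatedPrime_iff] at hP
  obtain ⟨hprime, x, hx⟩ := hP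
  obtain ⟨f, rfl⟩ := Ideal.Quotient.mk_surjective x
  have hmem : ∀ g, g ∈ P ↔
      ∀ G, Minimal (IsWindowCover n t) G → Polynomial.X ^ s ∣ scaleVars K G (g * f) := by
    intro g
    rw [hx, Submodule.mem_colon_singleton, Submodule.mem_bot, ← mem_pathIdeal_pow_iff,
      ← Ideal.Quotient.eq_zero_iff_mem, map_mul]
    rfl
  let J : Finset (Fin n) → Ideal (MvPolynomial (Fin n) K) := fun G =>
    ((Ideal.span {Polynomial.X ^ s}).comap (scaleVars K G)).colon {f}
  have hJ : ∀ G g, g ∈ J G ↔ Polynomial.X ^ s ∣ scaleVars K G (g * f) := fun G g => by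
    rw [Submodule.mem_colon_singleton, smul_eq_mul, Ideal.mem_comap, Ideal.mem_span_singleton]
  have hinf : (Finset.univ.filter (Minimal (IsWindowCover n t))).inf J ≤ P := by
    intro g hg
    rw [hmem]
    intro G hG
    rw [← hJ]
    exact Finset.inf_le (f := J) (Finset.mem_filter.2 ⟨Finset.mem_univ G, hG⟩) hg
  obtain ⟨G, hG, hGP⟩ := (Ideal.IsPrime.inf_le' hprime).1 hinf
  replace hG := (Finset.mem_filter.1 hG).2
  have hf : ¬ Polynomial.X ^ s ∣ scaleVars K G f := fun hf =>
    hprime.ne_top ((Ideal.eq_top_iff_one _).2 (hGP ((hJ G 1).2 (by rwa [one_mul]))))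
  refine ⟨G, hG, le_antisymm (fun g hg => ?_) ?_⟩
  · rw [← X_dvd_scaleVars_iff]
    by_contra hdvd
    have := (hmem g).1 hg G hG
    rw [map_mul] at this
    exact hf (Polynomial.prime_X.pow_dvd_of_dvd_mul_left s hdvd this)
  · rw [Ideal.span_le]
    rintro _ ⟨j, hj, rfl⟩
    refine hprime.mem_of_pow_mem s (hGP ((hJ G _).2 ?_))
    rw [map_mul, map_pow]
    refine Dvd.dvd.mul_right (pow_dvd_pow_of_dvd ?_ s) _
    rw [X_dvd_scaleVars_iff]
    exact Ideal.subset_span ⟨j, hj, rfl⟩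

theorem span_X_image_mem_minimalPrimes (K : Type*) [Field K] {n t s : ℕ} (hs : 1 ≤ s)
    {G : Finset (Fin n)} (hG : Minimal (IsWindowCover n t) G) :
    Ideal.span (X '' (G : Set (Fin n))) ∈ (pathIdeal K n t ^ s).minimalPrimes := by
  classical
  refine ⟨⟨isPrime_span_X_image K G,
    (Ideal.pow_le_self (by omega)).trans (pathIdeal_le_span_X_image K hG.prop)⟩, ?_⟩
  rintro Q ⟨hQ, hIQ⟩ hQG
  replace hIQ := hQ.le_of_pow_le hIQ
  have hcov : IsWindowCover n t (G.filter fun j => X j ∈ Q) := by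
    intro i hi
    have : pathGen K n t i ∈ Q := hIQ (Ideal.subset_span ⟨i, hi, rfl⟩)
    obtain ⟨j, hj, hjQ⟩ := (hQ.prod_mem_iff).1 this
    refine ⟨j, Finset.mem_filter.2 ⟨?_, hjQ⟩, by simpa using hj⟩
    obtain ⟨k, hk, hne⟩ := mem_ideal_span_X_image.1 (hQG hjQ) (Finsupp.single j 1) (by simp)
    have : k = j := by
      by_contra hkj
      exact hne (Finsupp.single_eq_of_ne hkj)
    exact this ▸ hk
  rw [Ideal.span_le]
  rintro _ ⟨j, hj, rfl⟩
  exact (Finset.mem_filter.1 (hG.le_of_le hcov (Finset.filter_subset _ _) hj)).2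

/-- For every `s ≥ 1`, the associated primes of `S/I_t(L_n)^s` are exactly
`{p_F : F ∈ C_{n,t}}`. -/
theorem associatedPrimes_pathIdeal_pow (K : Type*) [Field K] (n t : ℕ)
    (ht : 2 ≤ t) (htn : t ≤ n) (s : ℕ) (hs : 1 ≤ s) :
    associatedPrimes (MvPolynomial (Fin n) K)
        (MvPolynomial (Fin n) K ⧸ (pathIdeal K n t ^ s)) =
      {P | ∃ F : Finset ℕ, memC n t F ∧ P = pF K n F} := by
  ext P
  constructor
  · intro hP
    obtain ⟨G, hG, rfl⟩ := exists_minimal_of_mem_associatedPrimes K hP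
    exact ⟨_, memC_image_of_minimal htn hG, (pF_image K G).symm⟩
  · rintro ⟨F, hF, rfl⟩
    obtain ⟨G, hG, rfl⟩ := hF.exists_minimal_isWindowCover htn
    rw [pF_image]
    apply Module.associatedPrimes.minimalPrimes_annihilator_subset_associatedPrimes
    rw [Ideal.annihilator_quotient]
    exact span_X_image_mem_minimalPrimes K hs hG
end

section
/- Let K be a field, 2 ≤ t ≤ n, and S = K[x_1,…,x_n]. For every s ≥ 2, the colon ideal I_t(L_n)^s : u_{n−t+1} equals I_t(L_n)^{s−1}, where u_{n−t+1} = x_{n−t+1} x_{n−t+2} ⋯ x_n. -/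
open MvPolynomial

/-- The last generator `u_{n-t+1} = x_{n-t+1} x_{n-t+2} ⋯ x_n` of `I_t(L_n)`. -/
noncomputable def lastGen (K : Type*) [Field K] (n t : ℕ) : MvPolynomial (Fin n) K :=
  ∏ j ∈ Finset.univ.filter (fun j : Fin n => n - t ≤ (j : ℕ)), X j

/-- The exponent vector of `pathGen K n t i`. -/
noncomputable def pathExp (n t i : ℕ) : Fin n →₀ ℕ :=
  Finsupp.equivFunOnFinite.symm fun j => if i ≤ (j : ℕ) ∧ (j : ℕ) < i + t then 1 else 0

lemma pathExp_apply (n t i : ℕ) (j : Fin n) :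
    pathExp n t i j = if i ≤ (j : ℕ) ∧ (j : ℕ) < i + t then 1 else 0 := rfl

lemma pathGen_eq_monomial_s13 (K : Type*) [Field K] (n t i : ℕ) :
    pathGen K n t i = monomial (pathExp n t i) 1 := by
  rw [pathGen, monomial_eq, Finsupp.prod_fintype _ _ (fun _ => pow_zero _), Finset.prod_filter]
  simp only [C_1, one_mul]
  refine Finset.prod_congr rfl fun j _ => ?_
  rw [pathExp_apply]
  split_ifs <;> simp

lemma lastGen_eq_pathGen (K : Type*) [Field K] (n t : ℕ) (htn : t ≤ n) :
    lastGen K n t = pathGen K n t (n - t) := by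
  rw [lastGen, pathGen]
  congr 1
  ext j
  have := j.isLt
  simp only [Finset.mem_filter, Finset.mem_univ, true_and]
  omega

lemma pathIdeal_pow_eq_span (K : Type*) [Field K] (n t s : ℕ) :
    pathIdeal K n t ^ s = Ideal.span ((fun d => monomial d (1 : K)) ''
      {d | ∃ M : Multiset ℕ, M.card = s ∧ (∀ i ∈ M, i + t ≤ n) ∧
        d = (M.map (pathExp n t)).sum}) := by
  induction s with
  | zero =>
    rw [pow_zero, Ideal.one_eq_top, eq_comm, Ideal.eq_top_iff_one]
    exact Ideal.subset_span ⟨0, ⟨0, by simp⟩, rfl⟩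
  | succ s ih =>
    rw [pow_succ, ih, pathIdeal, Ideal.span_mul_span']
    congr 1
    ext f
    simp only [Set.mem_mul, Set.mem_image, Set.mem_ofPred_eq]
    constructor
    · rintro ⟨_, ⟨_, ⟨M, hM, hMn, rfl⟩, rfl⟩, _, ⟨i, hi, rfl⟩, rfl⟩
      refine ⟨_, ⟨i ::ₘ M, by simp [hM], by simpa using ⟨hi, hMn⟩, rfl⟩, ?_⟩
      rw [pathGen_eq_monomial_s13, monomial_mul, Multiset.map_cons, Multiset.sum_cons, add_comm,
        one_mul]
    · rintro ⟨_, ⟨M, hM, hMn, rfl⟩, rfl⟩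
      obtain ⟨i, hi⟩ := Multiset.card_pos_iff_exists_mem.1 (by omega : 0 < M.card)
      obtain ⟨M, rfl⟩ := Multiset.exists_cons_of_mem hi
      rw [Multiset.forall_mem_cons] at hMn
      refine ⟨_, ⟨_, ⟨M, by simpa using hM, hMn.2, rfl⟩, rfl⟩, _, ⟨i, hMn.1, rfl⟩, ?_⟩
      rw [pathGen_eq_monomial_s13, monomial_mul, Multiset.map_cons, Multiset.sum_cons, add_comm,
        one_mul]

/-- Dropping the rightmost path of a product of paths dividing `d` times the last path leaves a
product dividing `d`. -/
lemma sum_pathExp_le_of_cons_le {n t i : ℕ} {M : Multiset ℕ} {d : Fin n →₀ ℕ} (hi : i + t ≤ n)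
    (hM : ∀ k ∈ M, k ≤ i)
    (h : ((i ::ₘ M).map (pathExp n t)).sum ≤ d + pathExp n t (n - t)) :
    (M.map (pathExp n t)).sum ≤ d := by
  intro p
  have hp := h p
  have := p.isLt
  simp only [Multiset.map_cons, Multiset.sum_cons, Finsupp.add_apply, pathExp_apply] at hp
  by_cases hpi : (p : ℕ) < i + t
  · split_ifs at hp <;> omega
  · have hz : (M.map (pathExp n t)).sum p = 0 := by
      rw [← Finsupp.applyAddHom_apply, map_multiset_sum, Multiset.sum_eq_zero]
      simp only [Multiset.mem_map]
      rintro _ ⟨_, ⟨k, hk, rfl⟩, rfl⟩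
      have := hM k hk
      rw [Finsupp.applyAddHom_apply, pathExp_apply, if_neg (by omega)]
    omega

/-- For `s ≥ 2`, the colon ideal `I_t(L_n)^s : u_{n-t+1}` equals `I_t(L_n)^{s-1}`. -/
theorem pathIdeal_pow_colon_lastGen (K : Type*) [Field K] (n t : ℕ)
    (ht : 2 ≤ t) (htn : t ≤ n) (s : ℕ) (hs : 2 ≤ s) :
    (pathIdeal K n t ^ s).colon (Ideal.span {lastGen K n t}) = pathIdeal K n t ^ (s - 1) := by
  obtain ⟨s, rfl⟩ : ∃ r, s = r + 1 := ⟨s - 1, by omega⟩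
  rw [Nat.add_sub_cancel, lastGen_eq_pathGen K n t htn]
  ext f
  rw [Ideal.mem_colon_span_singleton]
  constructor
  · intro hf
    rw [pathGen_eq_monomial_s13, pathIdeal_pow_eq_span, mem_ideal_span_monomial_image] at hf
    rw [pathIdeal_pow_eq_span, mem_ideal_span_monomial_image]
    intro d hd
    obtain ⟨_, ⟨M, hM, hMn, rfl⟩, hle⟩ := hf (d + pathExp n t (n - t)) (by
      rw [mem_support_iff, coeff_mul_monomial, mul_one]
      exact mem_support_iff.1 hd)
    have hne : M.toFinset.Nonempty := by
      obtain ⟨i, hi⟩ := Multiset.card_pos_iff_exists_mem.1 (by omega : 0 < M.card)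
      exact ⟨i, Multiset.mem_toFinset.2 hi⟩
    obtain ⟨i, hi, hmax⟩ := M.toFinset.exists_max_image id hne
    obtain ⟨M, rfl⟩ := Multiset.exists_cons_of_mem (Multiset.mem_toFinset.1 hi)
    rw [Multiset.forall_mem_cons] at hMn
    refine ⟨_, ⟨M, by simpa using hM, hMn.2, rfl⟩, sum_pathExp_le_of_cons_le hMn.1 ?_ hle⟩
    exact fun k hk => hmax k (by simp [hk])
  · intro hf
    rw [pow_succ]
    exact Ideal.mul_mem_mul hf (Ideal.subset_span ⟨n - t, Nat.sub_add_cancel htn |>.le, rfl⟩)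
end
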